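/- Let k ≥ 1 be a fixed integer and let f : ℕ → ℝ be such that m = m(n) = ⌊(n/2)·(log n + (k−1)·log log n + f(n))⌋ satisfies 0 ≤ m ≤ N for all large n. If f(n) → ∞ as n → ∞, then the probability that G_{n,m} has minimum degree at least k tends to 1; if f(n) → −∞, then this probability tends to 0. -/

import Mathlib

open Finset Filter

namespace RGP

/-- Number of edges of the complete graph on `n` vertices. -/
def numEdges (n : ℕ) : ℕ := n * (n - 1) / 2

/-- An edge of the complete graph on `Fin n` (an unordered pair of distinct vertices). -/
abbrev EdgeType (n : ℕ) := {e : Sym2 (Fin n) // ¬ e.IsDiag}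

/-- A uniformly random permutation of the edges of `K_n` is modelled by a bijection
`σ` between positions `Fin (numEdges n)` and edges; `σ i` is the edge `e_{i+1}`. -/
abbrev Ord (n : ℕ) := Fin (numEdges n) ≃ EdgeType n

/-- Degree of a vertex `v` in a set `S` of edges. -/
def deg {n : ℕ} (S : Finset (Sym2 (Fin n))) (v : Fin n) : ℕ :=
  (S.filter (fun e => v ∈ e)).card

/-- The edge set `{e_1, …, e_m}` of `G_{n,m}` in the random graph process `σ`. -/
def procEdges {n : ℕ} (σ : Ord n) (m : ℕ) : Finset (Sym2 (Fin n)) :=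
  (Finset.univ.filter (fun i : Fin (numEdges n) => (i : ℕ) < m)).image (fun i => (σ i).1)

/-- The hitting time `τ_k` for minimum degree at least `k`. -/
noncomputable def tau {n : ℕ} (k : ℕ) (σ : Ord n) : ℕ :=
  sInf {m | ∀ v : Fin n, k ≤ deg (procEdges σ m) v}

open scoped Classical in
/-- The probability of an event under the uniformly random edge ordering. -/
noncomputable def Pr {n : ℕ} (p : Ord n → Prop) : ℝ :=
  ((Finset.univ : Finset (Ord n)).filter p).card / (Fintype.card (Ord n) : ℝ)

/-- A deterministic online strategy: given the sequence of edges revealed so far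
(the last entry being the edge just revealed), decide whether to purchase it. -/
abbrev Strategy (n : ℕ) := List (Sym2 (Fin n)) → Bool

/-- The list of the first `i` revealed edges `e_1, …, e_i`. -/
def prefixList {n : ℕ} (σ : Ord n) (i : ℕ) : List (Sym2 (Fin n)) :=
  (List.range i).filterMap (fun j => if h : j < numEdges n then some (σ ⟨j, h⟩).1 else none)

/-- `buy st σ i` is the edge set of Builder's graph `B_i`: the edges purchased by the
strategy `st` among `e_1, …, e_i`. -/
def buy {n : ℕ} (st : Strategy n) (σ : Ord n) : ℕ → Finset (Sym2 (Fin n))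
  | 0 => ∅
  | i + 1 =>
    if h : i < numEdges n then
      if st (prefixList σ (i + 1)) then insert (σ ⟨i, h⟩).1 (buy st σ i)
      else buy st σ i
    else buy st σ i

end RGP

namespace RGP

open scoped Classical in
theorem equidist {E : Type*} [Fintype E] [DecidableEq E] {N m : ℕ} (hN : Fintype.card E = N) (hm : m ≤ N)
    (p : Finset E → Prop) :
    ((univ : Finset (Fin N ≃ E)).filter
      (fun σ => p ((univ.filter (fun i : Fin N => (i : ℕ) < m)).map σ.toEmbedding))).card
        * N.choose m =
      ((powersetCard m (univ : Finset E)).filter p).card * Fintype.card (Fin N ≃ E) := by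
  set F : (Fin N ≃ E) → Finset E :=
    fun σ => (univ.filter (fun i : Fin N => (i : ℕ) < m)).map σ.toEmbedding with hF
  have hcard : ∀ σ, (F σ).card = m := by
    intro σ
    simp only [hF, card_map]
    rw [Fin.card_filter_val_lt]; simpa using hm
  have key : ∀ T1 ∈ powersetCard m (univ : Finset E), ∀ T2 ∈ powersetCard m (univ : Finset E),
      (univ.filter (fun σ => F σ = T1)).card ≤ (univ.filter (fun σ => F σ = T2)).card := by
    intro T1 h1 T2 h2
    rw [mem_powersetCard] at h1 h2
    obtain ⟨π, hπ⟩ : ∃ π : Equiv.Perm E, T1.map π.toEmbedding = T2 := by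
      have e : {x // x ∈ T1} ≃ {x // x ∈ T2} :=
        Fintype.equivOfCardEq (by simp [h1.2, h2.2])
      refine ⟨e.extendSubtype, ?_⟩
      apply Finset.eq_of_subset_of_card_le
      · intro x hx
        simp only [Finset.mem_map, Equiv.coe_toEmbedding] at hx
        obtain ⟨y, hy, rfl⟩ := hx
        exact e.extendSubtype_mem y hy
      · simp [h1.2, h2.2]
    apply Finset.card_le_card_of_injOn (fun σ => σ.trans π)
    · intro σ hσ
      simp only [Finset.coe_filter, Finset.mem_univ, true_and, Set.mem_ofPred_eq] at hσ ⊢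
      rw [← hπ, ← hσ, hF]
      simp only [Finset.map_map]
      congr 1
    · intro a _ b _ hab
      ext x
      have := congrArg (fun g : Fin N ≃ E => g x) hab
      simpa using this
  have hne : (powersetCard m (univ : Finset E)).Nonempty := by
    rw [powersetCard_nonempty]; simpa [hN] using hm
  obtain ⟨T0, hT0⟩ := hne
  set c := (univ.filter (fun σ => F σ = T0)).card with hc
  have hfib : ∀ T ∈ powersetCard m (univ : Finset E),
      (univ.filter (fun σ => F σ = T)).card = c :=
    fun T hT => le_antisymm (key T hT T0 hT0) (key T0 hT0 T hT)
  have hcount : ∀ q : Finset E → Prop, ((univ : Finset (Fin N ≃ E)).filter (fun σ => q (F σ))).card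
      = ((powersetCard m (univ : Finset E)).filter q).card * c := by
    intro q
    rw [Finset.card_eq_sum_card_fiberwise (f := F)
      (t := (powersetCard m (univ : Finset E)).filter q)]
    · rw [← smul_eq_mul, ← Finset.sum_const]
      apply Finset.sum_congr rfl
      intro T hT
      rw [Finset.mem_filter] at hT
      rw [← hfib T hT.1, Finset.filter_filter]
      congr 1
      ext σ
      simp only [Finset.mem_filter, Finset.mem_univ, true_and]
      constructor
      · exact fun h => h.2
      · exact fun h => ⟨h ▸ hT.2, h⟩
    · intro σ hσ
      simp only [Finset.coe_filter, Finset.mem_univ, true_and, Set.mem_ofPred_eq] at hσ ⊢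
      exact ⟨by simp [mem_powersetCard, hcard], hσ⟩
  have htot := hcount (fun _ => True)
  simp only [Finset.filter_true, Finset.card_univ, card_powersetCard, hN] at htot
  rw [hcount p, htot]; ring

theorem card_edge (n : ℕ) : Fintype.card (EdgeType n) = numEdges n := by
  rw [Sym2.card_subtype_not_diag, Nat.choose_two_right]; simp [numEdges]

/-- star of a vertex -/
def star {n : ℕ} (v : Fin n) : Finset (EdgeType n) := univ.filter (fun e => v ∈ e.1)

theorem star_card {n : ℕ} (v : Fin n) : (star v).card = n - 1 := by
  have : (star v).card = ((univ : Finset (Fin n)).erase v).card := by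
    symm
    apply Finset.card_bij (fun w hw => (⟨s(v, w), by
      simp only [Sym2.mk_isDiag_iff]; exact fun h => (Finset.ne_of_mem_erase hw) h.symm⟩ : EdgeType n))
    · intro w hw; simp [star]
    · intro a ha b hb hab
      simp only [Subtype.mk.injEq, Sym2.congr_right] at hab
      exact hab
    · rintro ⟨e, he⟩ h
      simp only [star, Finset.mem_filter, Finset.mem_univ, true_and] at h
      obtain ⟨w, rfl⟩ := h
      refine ⟨w, ?_, rfl⟩
      simp only [Finset.mem_erase, Finset.mem_univ, and_true]
      rintro rfl
      exact he (by simp)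
  rw [this]; simp

theorem star_inter {n : ℕ} {u v : Fin n} (huv : u ≠ v) :
    ∃ e, star u ∩ star v = {e} := by
  refine ⟨⟨s(u, v), by simpa using huv⟩, ?_⟩
  ext ⟨e, he⟩
  simp only [star, Finset.mem_inter, Finset.mem_filter, Finset.mem_univ, true_and,
    Finset.mem_singleton, Subtype.mk.injEq]
  exact Sym2.mem_and_mem_iff huv

theorem deg_eq {n : ℕ} (σ : Ord n) (m : ℕ) (v : Fin n) :
    deg (procEdges σ m) v =
      ((univ.filter (fun i : Fin (numEdges n) => (i : ℕ) < m)).map σ.toEmbedding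
        ∩ star v).card := by
  unfold deg procEdges
  symm
  apply Finset.card_bij (fun e _ => e.1)
  · rintro e he
    simp only [star, Finset.mem_inter, Finset.mem_map, Finset.mem_filter, Finset.mem_univ, true_and,
      Finset.mem_image] at he ⊢
    obtain ⟨⟨i, hi, rfl⟩, h2⟩ := he
    exact ⟨⟨i, hi, rfl⟩, h2⟩
  · intro a _ b _ h; exact Subtype.ext h
  · intro e he
    simp only [Finset.mem_filter, Finset.mem_univ, true_and,
      Finset.mem_image] at he
    obtain ⟨⟨i, hi, rfl⟩, h2⟩ := he
    refine ⟨σ i, ?_, rfl⟩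
    simp only [star, Finset.mem_inter, Finset.mem_map, Finset.mem_filter, Finset.mem_univ, true_and]
    exact ⟨⟨i, hi, rfl⟩, h2⟩

open scoped Classical in
theorem Pr_eq {n m : ℕ} (hm : m ≤ numEdges n) (k : ℕ) :
    Pr (fun σ : Ord n => ∀ v : Fin n, k ≤ deg (procEdges σ m) v) =
      (((powersetCard m (univ : Finset (EdgeType n))).filter
        (fun T => ∀ v, k ≤ (T ∩ star v).card)).card : ℝ) / ((numEdges n).choose m : ℝ) := by
  unfold Pr
  have h := equidist (card_edge n) hm (fun T => ∀ v, k ≤ (T ∩ star v).card)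
  have hc : 0 < (numEdges n).choose m := Nat.choose_pos hm
  have ho : 0 < Fintype.card (Ord n) := by
    have : Nonempty (Ord n) :=
      ⟨Fintype.equivOfCardEq ((Fintype.card_fin _).trans (card_edge n).symm)⟩
    exact Fintype.card_pos
  have hc' : (((numEdges n).choose m : ℕ) : ℝ) ≠ 0 := by exact_mod_cast hc.ne'
  have ho' : ((Fintype.card (Ord n) : ℕ) : ℝ) ≠ 0 := by exact_mod_cast ho.ne'
  rw [div_eq_div_iff ho' hc', ← Nat.cast_mul, ← Nat.cast_mul, Nat.cast_inj]
  simp_rw [deg_eq]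
  convert h

theorem Pr_mono {n m m' : ℕ} (h : m ≤ m') (k : ℕ) :
    Pr (fun σ : Ord n => ∀ v : Fin n, k ≤ deg (procEdges σ m) v) ≤
    Pr (fun σ : Ord n => ∀ v : Fin n, k ≤ deg (procEdges σ m') v) := by
  unfold Pr
  apply div_le_div_of_nonneg_right _ (by positivity)
  norm_cast
  apply Finset.card_le_card
  intro σ hσ
  simp only [Finset.mem_filter, Finset.mem_univ, true_and] at hσ ⊢
  intro v
  refine (hσ v).trans ?_
  unfold deg procEdges
  apply Finset.card_le_card
  apply Finset.filter_subset_filter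
  apply Finset.image_subset_image
  intro i hi
  simp only [Finset.mem_filter, Finset.mem_univ, true_and] at hi ⊢
  omega

theorem count_single {E : Type*} [Fintype E] [DecidableEq E] (A : Finset E) {m j : ℕ} (hj : j ≤ m) :
    ((powersetCard m (univ : Finset E)).filter (fun T => (T ∩ A).card = j)).card =
      A.card.choose j * (Fintype.card E - A.card).choose (m - j) := by
  rw [← Finset.card_compl, ← card_powersetCard, ← card_powersetCard, ← Finset.card_product]
  apply Finset.card_bij' (fun T _ => (T ∩ A, T ∩ Aᶜ)) (fun P _ => P.1 ∪ P.2)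
  · intro T hT
    simp only [Finset.mem_filter, mem_powersetCard, Finset.mem_product] at hT ⊢
    have : (T ∩ A).card + (T ∩ Aᶜ).card = T.card := by
      rw [← Finset.sdiff_eq_inter_compl, Finset.card_inter_add_card_sdiff]
    refine ⟨⟨Finset.inter_subset_right, hT.2⟩, Finset.inter_subset_right, by omega⟩
  · rintro ⟨P, Q⟩ h
    simp only [Finset.mem_filter, mem_powersetCard, Finset.mem_product] at h ⊢
    have hd : Disjoint P Q := Finset.disjoint_of_subset_left h.1.1
      (Finset.disjoint_of_subset_right h.2.1 disjoint_compl_right)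
    refine ⟨⟨Finset.subset_univ _, ?_⟩, ?_⟩
    · rw [Finset.card_union_of_disjoint hd]; omega
    · rw [← h.1.2]; congr 1
      ext x; have := @h.1.1 x; have := @h.2.1 x
      simp only [Finset.mem_inter, Finset.mem_union, Finset.mem_compl] at *; tauto
  · intro T _
    ext x; simp only [Finset.mem_inter, Finset.mem_union, Finset.mem_compl]; tauto
  · rintro ⟨P, Q⟩ h
    simp only [Finset.mem_filter, mem_powersetCard, Finset.mem_product] at h
    ext x
    · have := @h.1.1 x; have := @h.2.1 x
      simp only [Finset.mem_inter, Finset.mem_union, Finset.mem_compl] at *; tauto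
    · have := @h.1.1 x; have := @h.2.1 x
      simp only [Finset.mem_inter, Finset.mem_union, Finset.mem_compl] at *; tauto

theorem count_triple {E : Type*} [Fintype E] [DecidableEq E] (S : Finset (Finset E))
    (P Q R D : Finset E) (a b c : ℕ)
    (h : ∀ T ∈ S, (T ∩ P).card = a ∧ (T ∩ Q).card = b ∧ (T ∩ R).card = c)
    (hD : ∀ T ∈ S, T = (T ∩ P) ∪ (T ∩ Q) ∪ (T ∩ R) ∪ D) :
    S.card ≤ P.card.choose a * Q.card.choose b * R.card.choose c := by
  rw [← card_powersetCard, ← card_powersetCard, ← card_powersetCard, ← Finset.card_product,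
    ← Finset.card_product]
  apply Finset.card_le_card_of_injOn (fun T => ((T ∩ P, T ∩ Q), T ∩ R))
  · intro T hT
    simp only [Finset.coe_product, Set.mem_prod, Finset.mem_coe, mem_powersetCard]
    exact ⟨⟨⟨Finset.inter_subset_right, (h T hT).1⟩, ⟨Finset.inter_subset_right, (h T hT).2.1⟩⟩,
      ⟨Finset.inter_subset_right, (h T hT).2.2⟩⟩
  · intro T hT T' hT' he
    simp only [Prod.mk.injEq] at he
    rw [hD T hT, hD T' hT', he.1.1, he.1.2, he.2]

theorem count_pair {E : Type*} [Fintype E] [DecidableEq E] (A B : Finset E) (e : E)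
    (hAB : A ∩ B = {e}) {m j d : ℕ} (hA : A.card = d) (hB : B.card = d) (hd : 1 ≤ d)
    (hj : 2 * j ≤ m) :
    (((powersetCard m (univ : Finset E)).filter
      (fun T => (T ∩ A).card = j ∧ (T ∩ B).card = j)).card : ℝ) ≤
      (d.choose j : ℝ) ^ 2 * (Fintype.card E - (2 * d - 1)).choose (m - 2 * j) +
      ((j : ℝ) / d) ^ 2 * (d.choose j : ℝ) ^ 2 *
        (Fintype.card E - (2 * d - 1)).choose (m - 2 * j + 1) := by
  set S := (powersetCard m (univ : Finset E)).filter
      (fun T => (T ∩ A).card = j ∧ (T ∩ B).card = j) with hS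
  have heA : e ∈ A := (Finset.mem_inter.1 (hAB ▸ Finset.mem_singleton_self e)).1
  have heB : e ∈ B := (Finset.mem_inter.1 (hAB ▸ Finset.mem_singleton_self e)).2
  have huniq : ∀ x, x ∈ A → x ∈ B → x = e := fun x h1 h2 => by
    have : x ∈ A ∩ B := Finset.mem_inter.2 ⟨h1, h2⟩
    rw [hAB] at this; simpa using this
  have hPc : (A.erase e).card = d - 1 := by rw [Finset.card_erase_of_mem heA, hA]
  have hQc : (B.erase e).card = d - 1 := by rw [Finset.card_erase_of_mem heB, hB]
  have hRc : ((A ∪ B)ᶜ).card = Fintype.card E - (2 * d - 1) := by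
    rw [Finset.card_compl]
    have := Finset.card_union_add_card_inter A B
    rw [hAB, Finset.card_singleton] at this
    congr 1; omega
  have hsplit : ∀ T : Finset E, (T ∩ A ∪ T ∩ B).card + (T ∩ (A ∪ B)ᶜ).card = T.card := by
    intro T
    rw [← Finset.inter_union_distrib_left, ← Finset.sdiff_eq_inter_compl,
      Finset.card_inter_add_card_sdiff]
  have hui : ∀ T : Finset E, (T ∩ A ∪ T ∩ B).card + (T ∩ {e}).card = (T ∩ A).card + (T ∩ B).card := by
    intro T
    rw [← Finset.card_union_add_card_inter (T ∩ A) (T ∩ B), ← hAB]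
    congr 2; ext x; simp only [Finset.mem_inter]; tauto
  have h1 : (S.filter (fun T => e ∉ T)).card ≤
      (d - 1).choose j * (d - 1).choose j *
        (Fintype.card E - (2 * d - 1)).choose (m - 2 * j) := by
    have := count_triple (S.filter (fun T => e ∉ T)) (A.erase e) (B.erase e) ((A ∪ B)ᶜ) ∅ j j
      (m - 2 * j) ?_ ?_
    · rwa [hPc, hQc, hRc] at this
    · intro T hT
      simp only [hS, Finset.mem_filter, mem_powersetCard] at hT
      obtain ⟨⟨⟨-, hTm⟩, h1, h2⟩, h3⟩ := hT
      have e1 : T ∩ A.erase e = T ∩ A := by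
        rw [Finset.inter_erase, Finset.erase_eq_of_notMem]; simp [h3]
      have e2 : T ∩ B.erase e = T ∩ B := by
        rw [Finset.inter_erase, Finset.erase_eq_of_notMem]; simp [h3]
      have a1 := hsplit T
      have a2 := hui T
      have a3 : (T ∩ {e}).card = 0 := by simp [h3]
      rw [e1, e2]
      refine ⟨h1, h2, by omega⟩
    · intro T hT
      simp only [hS, Finset.mem_filter, mem_powersetCard] at hT
      ext x
      have hx : x = e → x ∉ T := fun h => h ▸ hT.2
      simp only [Finset.mem_inter, Finset.mem_union, Finset.mem_compl, Finset.mem_erase,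
        Finset.notMem_empty]
      tauto
  have h2 : ((S.filter (fun T => ¬ e ∉ T)).card : ℝ) ≤
      ((j : ℝ) / d) ^ 2 * (d.choose j : ℝ) ^ 2 *
        (Fintype.card E - (2 * d - 1)).choose (m - 2 * j + 1) := by
    rcases Nat.eq_zero_or_pos j with rfl | hjp
    · have : S.filter (fun T => ¬ e ∉ T) = ∅ := by
        apply Finset.filter_eq_empty_iff.2
        intro T hT
        simp only [hS, Finset.mem_filter, Finset.card_eq_zero] at hT
        intro h
        have : e ∈ T ∩ A := Finset.mem_inter.2 ⟨not_not.1 h, heA⟩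
        rw [hT.2.1] at this; simp at this
      rw [this]; simp
    have := count_triple (S.filter (fun T => ¬ e ∉ T)) (A.erase e) (B.erase e) ((A ∪ B)ᶜ) {e}
      (j - 1) (j - 1) (m - 2 * j + 1) ?_ ?_
    · rw [hPc, hQc, hRc] at this
      have hc : (d : ℝ) * (d - 1).choose (j - 1) = d.choose j * j := by
        obtain ⟨d', rfl⟩ : ∃ d', d = d' + 1 := ⟨d - 1, by omega⟩
        obtain ⟨j', rfl⟩ : ∃ j', j = j' + 1 := ⟨j - 1, by omega⟩
        have := Nat.add_one_mul_choose_eq d' j'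
        simp only [Nat.add_sub_cancel]
        exact_mod_cast this
      have hdp : (0 : ℝ) < d := by exact_mod_cast hd
      have hc' : ((d - 1).choose (j - 1) : ℝ) = (j : ℝ) / d * d.choose j := by
        field_simp; linarith
      rw [← mul_pow, ← hc', sq]
      exact_mod_cast this
    · intro T hT
      simp only [hS, Finset.mem_filter, mem_powersetCard, not_not] at hT
      obtain ⟨⟨⟨-, hTm⟩, h1, h2⟩, h3⟩ := hT
      have e1 : (T ∩ A.erase e).card = j - 1 := by
        rw [Finset.inter_erase, Finset.card_erase_of_mem (by simp [h3, heA]), h1]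
      have e2 : (T ∩ B.erase e).card = j - 1 := by
        rw [Finset.inter_erase, Finset.card_erase_of_mem (by simp [h3, heB]), h2]
      have a1 := hsplit T
      have a2 := hui T
      have a3 : (T ∩ {e}).card = 1 := by simp [h3]
      refine ⟨e1, e2, by omega⟩
    · intro T hT
      simp only [hS, Finset.mem_filter, mem_powersetCard, not_not] at hT
      ext x
      have hx : x = e → x ∈ T := fun h => h ▸ hT.2
      simp only [Finset.mem_inter, Finset.mem_union, Finset.mem_compl, Finset.mem_erase,
        Finset.mem_singleton]
      tauto
  rw [← Finset.card_filter_add_card_filter_not (s := S) (fun T => e ∉ T)]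
  push_cast
  refine add_le_add ?_ h2
  have h3 : (d - 1).choose j ≤ d.choose j := Nat.choose_le_choose j (by omega)
  calc ((S.filter (fun T => e ∉ T)).card : ℝ) ≤ (((d - 1).choose j * (d - 1).choose j *
        (Fintype.card E - (2 * d - 1)).choose (m - 2 * j) : ℕ) : ℝ) := by exact_mod_cast h1
    _ ≤ ((d.choose j * d.choose j *
        (Fintype.card E - (2 * d - 1)).choose (m - 2 * j) : ℕ) : ℝ) := by
        norm_cast; gcongr
    _ = _ := by push_cast; ring

open scoped Classical in
theorem second_moment {Ω V : Type*} [Fintype V] (S : Finset Ω) (A : V → Ω → Prop)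
    (c b : ℝ) (hc : 0 < c) (hb : 0 ≤ b) (hV : 0 < Fintype.card V) (hS : 0 < S.card)
    (h1 : ∀ v, ((S.filter (A v)).card : ℝ) = c)
    (h2 : ∀ u v, u ≠ v → ((S.filter (fun ω => A u ω ∧ A v ω)).card : ℝ) ≤ b) :
    ((S.filter (fun ω => ∀ v, ¬ A v ω)).card : ℝ) / S.card ≤
      S.card / (Fintype.card V * c) + (S.card * b / c ^ 2 - 1) := by
  set W : ℝ := (S.card : ℝ) with hW
  set n : ℝ := (Fintype.card V : ℝ) with hn
  have hWp : 0 < W := by rw [hW]; exact_mod_cast hS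
  have hnp : 0 < n := by rw [hn]; exact_mod_cast hV
  set X : Ω → ℝ := fun ω => ∑ v, if A v ω then 1 else 0 with hX
  have sX : ∑ ω ∈ S, X ω = n * c := by
    simp only [hX]
    rw [Finset.sum_comm]
    simp only [Finset.sum_boole, h1, Finset.sum_const, Finset.card_univ, nsmul_eq_mul, hn]
  have sX2 : ∑ ω ∈ S, X ω ^ 2 ≤ n * c + n ^ 2 * b := by
    have : ∀ ω, X ω ^ 2 = ∑ u, ∑ v, if A u ω ∧ A v ω then (1 : ℝ) else 0 := by
      intro ω
      simp only [hX, sq, Finset.sum_mul_sum]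
      refine Finset.sum_congr rfl fun u _ => Finset.sum_congr rfl fun v _ => ?_
      by_cases h : A u ω <;> by_cases h' : A v ω <;> simp [h, h']
    simp_rw [this]
    rw [Finset.sum_comm]
    calc ∑ u, ∑ ω ∈ S, ∑ v, (if A u ω ∧ A v ω then (1 : ℝ) else 0)
        ≤ ∑ u : V, (c + n * b) := by
          apply Finset.sum_le_sum
          intro u _
          rw [Finset.sum_comm]
          simp only [Finset.sum_boole]
          calc ∑ v, ((S.filter (fun ω => A u ω ∧ A v ω)).card : ℝ)
              ≤ ∑ v, ((if u = v then c else 0) + b) := by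
                apply Finset.sum_le_sum
                intro v _
                by_cases h : u = v
                · subst h; simp only [and_self, h1, if_true]; linarith
                · simp only [h, if_false, zero_add]; exact h2 u v h
            _ = c + n * b := by
                rw [Finset.sum_add_distrib]; simp [hn]
      _ = n * c + n ^ 2 * b := by simp only [Finset.sum_const, Finset.card_univ, nsmul_eq_mul, ← hn]; ring
  have hvar : ∑ ω ∈ S, (X ω * W - n * c) ^ 2 ≤ W ^ 2 * (n * c + n ^ 2 * b) - W * (n * c) ^ 2 := by
    have : ∑ ω ∈ S, (X ω * W - n * c) ^ 2 =
        W ^ 2 * ∑ ω ∈ S, X ω ^ 2 - 2 * W * (n * c) * ∑ ω ∈ S, X ω + W * (n * c) ^ 2 := by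
      rw [Finset.mul_sum, Finset.mul_sum, ← Finset.sum_sub_distrib]
      have : W * (n * c) ^ 2 = ∑ ω ∈ S, (n * c) ^ 2 := by simp [hW]
      rw [this, ← Finset.sum_add_distrib]
      refine Finset.sum_congr rfl fun ω _ => by ring
    rw [this, sX]
    have := mul_le_mul_of_nonneg_left sX2 (sq_nonneg W)
    nlinarith
  have hlow : ((S.filter (fun ω => ∀ v, ¬ A v ω)).card : ℝ) * (n * c) ^ 2 ≤
      ∑ ω ∈ S, (X ω * W - n * c) ^ 2 := by
    calc ((S.filter (fun ω => ∀ v, ¬ A v ω)).card : ℝ) * (n * c) ^ 2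
        = ∑ ω ∈ S.filter (fun ω => ∀ v, ¬ A v ω), (n * c) ^ 2 := by simp
      _ = ∑ ω ∈ S.filter (fun ω => ∀ v, ¬ A v ω), (X ω * W - n * c) ^ 2 := by
          apply Finset.sum_congr rfl
          intro ω hω
          rw [Finset.mem_filter] at hω
          have : X ω = 0 := by simp [hX, hω.2]
          rw [this]; ring
      _ ≤ _ := Finset.sum_le_sum_of_subset_of_nonneg (Finset.filter_subset _ _)
          (fun _ _ _ => sq_nonneg _)
  have h := hlow.trans hvar
  rw [div_le_iff₀ hWp]
  have hpos : 0 < (n * c) ^ 2 := by positivity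
  rw [← mul_le_mul_iff_left₀ hpos]
  refine h.trans (le_of_eq ?_)
  field_simp
  ring


theorem a_up (j : ℕ) : ∀ M r : ℕ, r ≤ M →
    (M + j) ^ j * M.choose r ≤ (r + j) ^ j * (M + j).choose (r + j) := by
  induction j with
  | zero => intro M r _; simp
  | succ j ih =>
    intro M r h
    have h1 := ih (M + 1) (r + 1) (by omega)
    have h2 := Nat.add_one_mul_choose_eq M r
    have h3 : (M + j + 1) * M.choose r ≤ (r + j + 1) * (M + 1).choose (r + 1) := by
      have : (M + j + 1) * (r + 1) ≤ (r + j + 1) * (M + 1) := by nlinarith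
      have h4 : (r + 1) * ((M + j + 1) * M.choose r) ≤ (r + 1) * ((r + j + 1) * (M + 1).choose (r + 1)) := by
        calc (r + 1) * ((M + j + 1) * M.choose r) = ((M + j + 1) * (r + 1)) * M.choose r := by ring
          _ ≤ ((r + j + 1) * (M + 1)) * M.choose r := by gcongr
          _ = (r + j + 1) * ((M + 1) * M.choose r) := by ring
          _ = _ := by rw [h2]; ring
      exact Nat.le_of_mul_le_mul_left h4 (by omega)
    have e1 : M + (j + 1) = M + 1 + j := by ring
    have e2 : r + (j + 1) = r + 1 + j := by ring
    rw [e1, e2]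
    calc (M + 1 + j) ^ (j + 1) * M.choose r = (M + 1 + j) ^ j * ((M + j + 1) * M.choose r) := by ring
      _ ≤ (M + 1 + j) ^ j * ((r + j + 1) * (M + 1).choose (r + 1)) := by gcongr
      _ = (r + j + 1) * ((M + 1 + j) ^ j * (M + 1).choose (r + 1)) := by ring
      _ ≤ (r + j + 1) * ((r + 1 + j) ^ j * (M + 1 + j).choose (r + 1 + j)) := by gcongr
      _ = _ := by ring

theorem a_low (j : ℕ) : ∀ M r : ℕ,
    r ^ j * (M + j).choose (r + j) ≤ (M + j) ^ j * M.choose r := by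
  induction j with
  | zero => intro M r; simp
  | succ j ih =>
    intro M r
    have h1 := ih (M + 1) (r + 1)
    have h2 := Nat.add_one_mul_choose_eq M r
    have e1 : M + (j + 1) = M + 1 + j := by ring
    have e2 : r + (j + 1) = r + 1 + j := by ring
    rw [e1, e2]
    calc r ^ (j + 1) * (M + 1 + j).choose (r + 1 + j)
        = r * (r ^ j * (M + 1 + j).choose (r + 1 + j)) := by ring
      _ ≤ (r + 1) * ((r + 1) ^ j * (M + 1 + j).choose (r + 1 + j)) := by
          have : r ^ j ≤ (r + 1) ^ j := Nat.pow_le_pow_left (by omega) j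
          apply Nat.mul_le_mul (by omega)
          exact Nat.mul_le_mul_right _ this
      _ ≤ (r + 1) * ((M + 1 + j) ^ j * (M + 1).choose (r + 1)) := by gcongr
      _ = (M + 1 + j) ^ j * ((M + 1).choose (r + 1) * (r + 1)) := by ring
      _ = (M + 1 + j) ^ j * ((M + 1) * M.choose r) := by rw [h2]
      _ ≤ (M + 1 + j) ^ j * ((M + 1 + j) * M.choose r) :=
          Nat.mul_le_mul_left _ (Nat.mul_le_mul_right _ (by omega))
      _ = _ := by ring

theorem choose_step (P r : ℕ) (h : r ≤ P + 1) :
    (P.choose r : ℝ) * (P + 1) = (P + 1).choose r * (P + 1 - r) := by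
  have := Nat.choose_mul_succ_eq P r
  have h2 : ((P.choose r * (P + 1) : ℕ) : ℝ) = ((P + 1).choose r * (P + 1 - r) : ℕ) := by
    exact_mod_cast this
  push_cast [Nat.cast_sub h] at h2
  exact h2

theorem lemA (r' r : ℕ) (hr : r' ≤ r) (t : ℕ) : ∀ P Q : ℕ, r' ≤ P → r ≤ Q →
    r * (P + t) ≤ r' * (Q + t) →
    (P.choose r' : ℝ) * (Q + t).choose r ≤ (P + t).choose r' * Q.choose r := by
  induction t with
  | zero => intro P Q _ _ _; simp
  | succ t ih =>
    intro P Q hP hQ h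
    have h1 := ih (P + 1) (Q + 1) (by omega) (by omega) (by
      calc r * (P + 1 + t) = r * (P + (t + 1)) := by ring
        _ ≤ r' * (Q + (t + 1)) := h
        _ = _ := by ring)
    have e1 : P + (t + 1) = P + 1 + t := by ring
    have e2 : Q + (t + 1) = Q + 1 + t := by ring
    have h0 : r * (P + 1) ≤ r' * (Q + 1) := by nlinarith
    rw [e1, e2]
    have s1 := choose_step P r' (by omega)
    have s2 := choose_step Q r (by omega)
    have h0' : (r : ℝ) * (P + 1) ≤ r' * (Q + 1) := by exact_mod_cast h0
    have hP' : (r' : ℝ) ≤ P := by exact_mod_cast hP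
    have hQ' : (r : ℝ) ≤ Q := by exact_mod_cast hQ
    have pP : (0 : ℝ) < P + 1 := by positivity
    have pQ : (0 : ℝ) < Q + 1 := by positivity
    have hpos : (0 : ℝ) < (P + 1) * (Q + 1) := by positivity
    rw [← mul_le_mul_iff_left₀ hpos]
    calc (P.choose r' : ℝ) * (Q + 1 + t).choose r * ((P + 1) * (Q + 1))
        = (P.choose r' * (P + 1)) * (Q + 1 + t).choose r * (Q + 1) := by ring
      _ = ((P + 1 : ℕ).choose r' * (Q + 1 + t).choose r) * ((P + 1 - r') * (Q + 1)) := by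
          rw [s1]; ring
      _ ≤ ((P + 1 + t).choose r' * (Q + 1 : ℕ).choose r) * ((P + 1 - r') * (Q + 1)) := by
          apply mul_le_mul_of_nonneg_right h1
          apply mul_nonneg <;> linarith
      _ ≤ ((P + 1 + t).choose r' * (Q + 1 : ℕ).choose r) * ((Q + 1 - r) * (P + 1)) := by
          apply mul_le_mul_of_nonneg_left _ (by positivity)
          nlinarith
      _ = ((P + 1 + t).choose r') * ((Q + 1 : ℕ).choose r * (Q + 1 - r)) * (P + 1) := by ring
      _ = _ := by rw [← s2]; ring

/-- Upper bound for the single ratio. -/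
theorem ratio_up (N d m j : ℕ) (hjd : j ≤ d) (hdN : d ≤ N) (hjm : j ≤ m) (hmN : m ≤ N)
    (hmd : m + d ≤ N + j) (hN : 0 < N) :
    ((N - d).choose (m - j) : ℝ) ≤
      ((m : ℝ) / N) ^ j * Real.exp (2 * j - (d : ℝ) * m / N) * N.choose m := by
  obtain ⟨r, rfl⟩ : ∃ r, m = r + j := ⟨m - j, by omega⟩
  obtain ⟨t, rfl⟩ : ∃ t, d = t + j := ⟨d - j, by omega⟩
  obtain ⟨s, rfl⟩ : ∃ s, N = r + s + t + j := ⟨N - r - t - j, by omega⟩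
  have e0 : r + s + t + j - (t + j) = r + s := by omega
  have e0' : r + j - j = r := by omega
  rw [e0, e0']
  have h1 := a_up j (r + s + t) r (by omega)
  have h2 := a_up t (r + s) s (by omega)
  have c1 : (r + s).choose s = (r + s).choose r := by
    rw [Nat.choose_symm_of_eq_add]; omega
  have c2 : (r + s + t).choose (s + t) = (r + s + t).choose r := by
    rw [Nat.choose_symm_of_eq_add]; omega
  rw [c1, c2] at h2
  have h1' : ((r + s + t + j : ℕ) : ℝ) ^ j * (r + s + t).choose r ≤
      ((r + j : ℕ) : ℝ) ^ j * (r + s + t + j).choose (r + j) := by exact_mod_cast h1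
  have h2' : ((r + s + t : ℕ) : ℝ) ^ t * (r + s).choose r ≤
      ((s + t : ℕ) : ℝ) ^ t * (r + s + t).choose r := by exact_mod_cast h2
  have hNp : (0 : ℝ) < ((r + s + t + j : ℕ) : ℝ) := by exact_mod_cast hN
  have k1 : ((r + s + t).choose r : ℝ) ≤
      (((r + j : ℕ) : ℝ) / ((r + s + t + j : ℕ) : ℝ)) ^ j * (r + s + t + j).choose (r + j) := by
    rw [div_pow, div_mul_eq_mul_div, le_div_iff₀ (by positivity)]
    linarith
  have k2 : ((r + s).choose r : ℝ) ≤ Real.exp (-((t : ℝ) * r / ((r + s + t + j : ℕ) : ℝ))) *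
      (r + s + t).choose r := by
    rcases Nat.eq_zero_or_pos t with rfl | htp
    · simp
    have hMp : (0 : ℝ) < ((r + s + t : ℕ) : ℝ) := by
      have : 0 < r + s + t := by omega
      exact_mod_cast this
    have : ((s + t : ℕ) : ℝ) ≤ ((r + s + t : ℕ) : ℝ) *
        Real.exp (-((r : ℝ) / ((r + s + t + j : ℕ) : ℝ))) := by
      have a1 := Real.add_one_le_exp (-((r : ℝ) / ((r + s + t + j : ℕ) : ℝ)))
      have a2 : (r : ℝ) / ((r + s + t + j : ℕ) : ℝ) ≤ (r : ℝ) / ((r + s + t : ℕ) : ℝ) := by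
        apply div_le_div_of_nonneg_left (by positivity) hMp
        push_cast; linarith [(Nat.cast_nonneg j : (0 : ℝ) ≤ j)]
      have a3 : ((r + s + t : ℕ) : ℝ) * (1 - (r : ℝ) / ((r + s + t : ℕ) : ℝ)) = ((s + t : ℕ) : ℝ) := by
        field_simp; push_cast; ring
      rw [← a3]
      apply mul_le_mul_of_nonneg_left _ hMp.le
      linarith
    have hp := pow_le_pow_left₀ (by positivity) this t
    rw [mul_pow, ← Real.exp_nat_mul] at hp
    have hp2 : ((r + s + t : ℕ) : ℝ) ^ t * (r + s).choose r ≤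
        ((r + s + t : ℕ) : ℝ) ^ t * (Real.exp (-((t : ℝ) * r / ((r + s + t + j : ℕ) : ℝ))) *
      (r + s + t).choose r) := by
      refine h2'.trans ?_
      rw [← mul_assoc]
      apply mul_le_mul_of_nonneg_right _ (by positivity)
      refine hp.trans (le_of_eq ?_)
      congr 2; ring
    exact le_of_mul_le_mul_left hp2 (by positivity)
  refine k2.trans ?_
  have k3 : Real.exp (-((t : ℝ) * r / ((r + s + t + j : ℕ) : ℝ))) ≤
      Real.exp (2 * j - ((t + j : ℕ) : ℝ) * ((r + j : ℕ) : ℝ) / ((r + s + t + j : ℕ) : ℝ)) := by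
    apply Real.exp_le_exp.2
    have : ((t + j : ℕ) : ℝ) * ((r + j : ℕ) : ℝ) / ((r + s + t + j : ℕ) : ℝ) -
        (t : ℝ) * r / ((r + s + t + j : ℕ) : ℝ) ≤ 2 * j := by
      rw [← sub_div, div_le_iff₀ hNp]
      push_cast
      have := (Nat.cast_nonneg j : (0 : ℝ) ≤ j)
      have := (Nat.cast_nonneg r : (0 : ℝ) ≤ r)
      have := (Nat.cast_nonneg s : (0 : ℝ) ≤ s)
      have := (Nat.cast_nonneg t : (0 : ℝ) ≤ t)
      have := mul_nonneg ‹(0 : ℝ) ≤ j› ‹(0 : ℝ) ≤ r›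
      have := mul_nonneg ‹(0 : ℝ) ≤ j› ‹(0 : ℝ) ≤ s›
      have := mul_nonneg ‹(0 : ℝ) ≤ j› ‹(0 : ℝ) ≤ t›
      have := mul_nonneg ‹(0 : ℝ) ≤ j› ‹(0 : ℝ) ≤ j›
      nlinarith
    linarith
  calc _ ≤ Real.exp (2 * j - ((t + j : ℕ) : ℝ) * ((r + j : ℕ) : ℝ) / ((r + s + t + j : ℕ) : ℝ)) *
      ((((r + j : ℕ) : ℝ) / ((r + s + t + j : ℕ) : ℝ)) ^ j * (r + s + t + j).choose (r + j)) := by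
        apply mul_le_mul k3 k1 (by positivity) (by positivity)
    _ = _ := by ring

/-- Lower bound for the single ratio. -/
theorem ratio_low (N d m j : ℕ) (hjd : j ≤ d) (hjm : 2 * j ≤ m)
    (hmd : m + d < N) :
    ((m : ℝ) / (2 * N)) ^ j * Real.exp (-((d : ℝ) * (d + m) / (N - d - m))) * N.choose m ≤
    ((N - d).choose (m - j) : ℝ) := by
  have hden : (0 : ℝ) < (N : ℝ) - d - m := by
    have : ((m + d : ℕ) : ℝ) < N := by exact_mod_cast hmd
    push_cast at this; linarith
  obtain ⟨r, rfl⟩ : ∃ r, m = r + j := ⟨m - j, by omega⟩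
  obtain ⟨t, rfl⟩ : ∃ t, d = t + j := ⟨d - j, by omega⟩
  obtain ⟨s, rfl⟩ : ∃ s, N = r + s + t + j := ⟨N - r - t - j, by omega⟩
  have e0 : r + s + t + j - (t + j) = r + s := by omega
  have e0' : r + j - j = r := by omega
  rw [e0, e0']
  have h1 := a_low j (r + s + t) r
  have h2 := a_low t (r + s) s
  have c1 : (r + s).choose s = (r + s).choose r := by
    rw [Nat.choose_symm_of_eq_add]; omega
  have c2 : (r + s + t).choose (s + t) = (r + s + t).choose r := by
    rw [Nat.choose_symm_of_eq_add]; omega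
  rw [c1, c2] at h2
  have h1' : (r : ℝ) ^ j * (r + s + t + j).choose (r + j) ≤ ((r + s + t + j : ℕ) : ℝ) ^ j * (r + s + t).choose r  := by exact_mod_cast h1
  have h2' : (s : ℝ) ^ t * (r + s + t).choose r ≤ ((r + s + t : ℕ) : ℝ) ^ t * (r + s).choose r := by
    exact_mod_cast h2
  have hs : 0 < s := by omega
  have hsp : (0 : ℝ) < s := by exact_mod_cast hs
  have hNp : (0 : ℝ) < ((r + s + t + j : ℕ) : ℝ) := by
    have : 0 < r + s + t + j := by omega
    exact_mod_cast this
  have hrj : (j : ℝ) ≤ r := by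
    have : j ≤ r := by omega
    exact_mod_cast this
  have k1 : (((r + j : ℕ) : ℝ) / (2 * ((r + s + t + j : ℕ) : ℝ))) ^ j * (r + s + t + j).choose (r + j)
      ≤ ((r + s + t).choose r : ℝ) := by
    rw [div_pow, div_mul_eq_mul_div, div_le_iff₀ (by positivity)]
    have : ((r + j : ℕ) : ℝ) ^ j ≤ (2 * (r : ℝ)) ^ j := by
      apply pow_le_pow_left₀ (by positivity); push_cast; linarith
    calc ((r + j : ℕ) : ℝ) ^ j * (r + s + t + j).choose (r + j)
        ≤ (2 * (r : ℝ)) ^ j * (r + s + t + j).choose (r + j) := by gcongr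
      _ = 2 ^ j * (r ^ j * (r + s + t + j).choose (r + j)) := by ring
      _ ≤ 2 ^ j * (((r + s + t + j : ℕ) : ℝ) ^ j * (r + s + t).choose r) := by gcongr
      _ = _ := by ring
  have hd2 : (((r + s + t + j : ℕ) : ℝ) - ((t + j : ℕ) : ℝ) - ((r + j : ℕ) : ℝ)) = s - j := by
    push_cast; ring
  rw [hd2] at hden ⊢
  have k2 : Real.exp (-(((t + j : ℕ) : ℝ) * (((t + j : ℕ) : ℝ) + ((r + j : ℕ) : ℝ)) / (s - j))) *
      (r + s + t).choose r ≤ ((r + s).choose r : ℝ) := by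
    have hMp : (0 : ℝ) < ((r + s + t : ℕ) : ℝ) := by push_cast; positivity
    have b1 : ((r + s + t : ℕ) : ℝ) * Real.exp (-(((r : ℝ) + t) / s)) ≤ s := by
      have a1 := Real.add_one_le_exp (((r : ℝ) + t) / s)
      have a2 : ((r : ℝ) + t) / s + 1 = ((r + s + t : ℕ) : ℝ) / s := by
        push_cast; field_simp; ring
      rw [a2, div_le_iff₀ hsp] at a1
      rw [Real.exp_neg, ← div_eq_mul_inv, div_le_iff₀ (Real.exp_pos _)]
      linarith
    have hp := pow_le_pow_left₀ (by positivity) b1 t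
    rw [mul_pow, ← Real.exp_nat_mul] at hp
    have b2 : Real.exp (-(((t + j : ℕ) : ℝ) * (((t + j : ℕ) : ℝ) + ((r + j : ℕ) : ℝ)) / (s - j))) ≤
        Real.exp ((t : ℝ) * (-(((r : ℝ) + t) / s))) := by
      apply Real.exp_le_exp.2
      rw [mul_neg, neg_le_neg_iff, ← mul_div_assoc]
      have hj0 := (Nat.cast_nonneg j : (0 : ℝ) ≤ j)
      apply div_le_div₀ (by positivity) _ hden (by linarith)
      push_cast
      apply mul_le_mul _ _ (by positivity) (by positivity) <;> linarith
    refine (mul_le_mul_of_nonneg_right b2 (by positivity)).trans ?_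
    have hp2 : ((r + s + t : ℕ) : ℝ) ^ t * (Real.exp ((t : ℝ) * (-(((r : ℝ) + t) / s))) *
      (r + s + t).choose r) ≤ ((r + s + t : ℕ) : ℝ) ^ t * (r + s).choose r := by
      rw [← mul_assoc]
      exact (mul_le_mul_of_nonneg_right hp (by positivity)).trans h2'
    exact le_of_mul_le_mul_left hp2 (by positivity)
  refine le_trans ?_ k2
  calc _ = Real.exp (-(((t + j : ℕ) : ℝ) * (((t + j : ℕ) : ℝ) + ((r + j : ℕ) : ℝ)) / (s - j))) *
     ((((r + j : ℕ) : ℝ) / (2 * ((r + s + t + j : ℕ) : ℝ))) ^ j * (r + s + t + j).choose (r + j)) := by ring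
    _ ≤ _ := by gcongr

/-- Pair bound. -/
theorem pair_bound (N d m j : ℕ) (hjd : j ≤ d) (hjm : 2 * j ≤ m) (hmd : m + 2 * d < N)
    (hbig : j * N ≤ (m - j) * d) :
    ((N - 2 * d).choose (m - 2 * j) : ℝ) * N.choose m ≤
      ((N : ℝ) / (N - d)) ^ j * ((N - d).choose (m - j) : ℝ) ^ 2 := by
  obtain ⟨q, rfl⟩ : ∃ q, m = q + 2 * j := ⟨m - 2 * j, by omega⟩
  obtain ⟨t, rfl⟩ : ∃ t, d = t + j := ⟨d - j, by omega⟩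
  obtain ⟨P, rfl⟩ : ∃ P, N = P + 2 * (t + j) := ⟨N - 2 * (t + j), by omega⟩
  have e1 : P + 2 * (t + j) - 2 * (t + j) = P := by omega
  have e2 : q + 2 * j - 2 * j = q := by omega
  have e3 : P + 2 * (t + j) - (t + j) = P + t + j := by omega
  have e4 : q + 2 * j - j = q + j := by omega
  rw [e4] at hbig
  rw [e1, e2, e3, e4]
  have A := lemA q (q + j) (by omega) t P (P + t + j) (by omega) (by omega) (by nlinarith)
  have B1 := a_up j (P + t) q (by omega)
  have B2 := a_low j (P + t + j + t) (q + j)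
  have e5 : P + t + j + t + j = P + 2 * (t + j) := by ring
  have e6 : q + j + j = q + 2 * j := by ring
  rw [e5, e6] at B2
  have B1' : ((P + t + j : ℕ) : ℝ) ^ j * (P + t).choose q ≤
    ((q + j : ℕ) : ℝ) ^ j * (P + t + j).choose (q + j) := by exact_mod_cast B1
  have B2' : ((q + j : ℕ) : ℝ) ^ j * (P + 2 * (t + j)).choose (q + 2 * j) ≤
    ((P + 2 * (t + j) : ℕ) : ℝ) ^ j * (P + t + j + t).choose (q + j) := by exact_mod_cast B2
  have e7 : (((P + 2 * (t + j) : ℕ) : ℝ) - ((t + j : ℕ) : ℝ)) = ((P + t + j : ℕ) : ℝ) := by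
    push_cast; ring
  rw [e7]
  have hPp : (0 : ℝ) < ((P + t + j : ℕ) : ℝ) := by
    have : 0 < P + t + j := by omega
    exact_mod_cast this
  rw [div_pow, div_mul_eq_mul_div, le_div_iff₀ (by positivity)]
  set x := (P.choose q : ℝ)
  set W := ((P + 2 * (t + j)).choose (q + 2 * j) : ℝ)
  set y := ((P + t + j).choose (q + j) : ℝ)
  set z := ((P + t).choose q : ℝ)
  set w := ((P + t + j + t).choose (q + j) : ℝ)
  set a := ((P + t + j : ℕ) : ℝ) ^ j
  set b := ((q + j : ℕ) : ℝ) ^ j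
  set c := ((P + 2 * (t + j) : ℕ) : ℝ) ^ j
  have hw : 0 < w := by
    have : 0 < (P + t + j + t).choose (q + j) := Nat.choose_pos (by omega)
    simp only [w]; exact_mod_cast this
  have hb : 0 < b := by
    rcases Nat.eq_zero_or_pos j with hj | hj
    · simp [b, hj]
    · have : 0 < q + j := by omega
      simp only [b]; positivity
  have hx : 0 ≤ x := by positivity
  have hy : 0 ≤ y := by positivity
  have hz : 0 ≤ z := by positivity
  have hW : 0 ≤ W := by positivity
  have ha : 0 ≤ a := by positivity
  have hc : 0 ≤ c := by positivity
  have : (x * W * a) * (w * b) ≤ (c * y ^ 2) * (w * b) := by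
    calc (x * W * a) * (w * b) = (x * w) * (b * W) * a := by ring
      _ ≤ (z * y) * (c * w) * a := by gcongr
      _ = (a * z) * (y * c * w) := by ring
      _ ≤ (b * y) * (y * c * w) := by gcongr
      _ = _ := by ring
  exact le_of_mul_le_mul_right this (by positivity)

/-- Bound for the pair counts relative to single counts. -/
theorem pair_ratio (N d m j : ℕ) (hjd : j ≤ d) (hd : 1 ≤ d) (hjm : 2 * j ≤ m) (hmd : m + 2 * d < N)
    (hbig : j * N ≤ (m - j) * d) :
    ((d.choose j : ℝ) ^ 2 * (N - (2 * d - 1)).choose (m - 2 * j) +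
      ((j : ℝ) / d) ^ 2 * (d.choose j : ℝ) ^ 2 *
        (N - (2 * d - 1)).choose (m - 2 * j + 1)) * N.choose m ≤
    (((N : ℝ) / (N - d)) ^ j * (N / (N - 2 * d - m)) *
      (1 + ((j : ℝ) / d) ^ 2 * (N / (m - 2 * j + 1)))) *
      ((d.choose j : ℝ) * (N - d).choose (m - j)) ^ 2 := by
  have hB := pair_bound N d m j hjd hjm hmd hbig
  obtain ⟨P, hP⟩ : ∃ P, N = P + 2 * d := ⟨N - 2 * d, by omega⟩
  obtain ⟨q, hq⟩ : ∃ q, m = q + 2 * j := ⟨m - 2 * j, by omega⟩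
  have e1 : N - (2 * d - 1) = P + 1 := by omega
  have e2 : m - 2 * j = q := by omega
  have e3 : N - 2 * d = P := by omega
  have e4 : (m : ℝ) - 2 * j + 1 = q + 1 := by rw [hq]; push_cast; ring
  have e5 : (N : ℝ) - 2 * d - m = P - m := by rw [hP]; push_cast; ring
  rw [e1, e2, e4, e5]
  rw [e2, e3] at hB
  have hPm : m < P := by omega
  have hPm' : (m : ℝ) < P := by exact_mod_cast hPm
  have hqm : (q : ℝ) ≤ m := by
    have : q ≤ m := by omega
    exact_mod_cast this
  have hPN : (P : ℝ) + 1 ≤ N := by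
    have : P + 1 ≤ N := by omega
    exact_mod_cast this
  have s1 := choose_step P q (by omega)
  have u1 : ((P + 1).choose q : ℝ) ≤ (N / (P - m)) * P.choose q := by
    rw [div_mul_eq_mul_div, le_div_iff₀ (by linarith)]
    have h0 : (0 : ℝ) ≤ (P + 1).choose q := by positivity
    have h1 : (0 : ℝ) ≤ P.choose q := by positivity
    calc ((P + 1).choose q : ℝ) * (P - m) ≤ (P + 1).choose q * (P + 1 - q) := by
          apply mul_le_mul_of_nonneg_left _ h0; linarith
      _ = P.choose q * (P + 1) := s1.symm
      _ ≤ N * P.choose q := by nlinarith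
  have u2 : ((P + 1).choose (q + 1) : ℝ) ≤ (N / (q + 1)) * (P + 1).choose q := by
    rw [div_mul_eq_mul_div, le_div_iff₀ (by positivity)]
    have := Nat.choose_succ_right_eq (P + 1) q
    calc ((P + 1).choose (q + 1) : ℝ) * (q + 1) = ((P + 1).choose q * (P + 1 - q) : ℕ) := by
          exact_mod_cast this
      _ ≤ ((P + 1).choose q * (P + 1) : ℕ) := by
          norm_cast; apply Nat.mul_le_mul_left; omega
      _ ≤ _ := by
          push_cast
          have h0 : (0 : ℝ) ≤ (P + 1).choose q := by positivity
          nlinarith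
  set X := (P.choose q : ℝ)
  set Y := ((P + 1).choose q : ℝ)
  set Z := ((P + 1).choose (q + 1) : ℝ)
  set D := (d.choose j : ℝ)
  set κ := ((j : ℝ) / d) ^ 2
  set W := (N.choose m : ℝ)
  set y := ((N - d).choose (m - j) : ℝ)
  set K := ((N : ℝ) / (N - d)) ^ j
  have hκ : 0 ≤ κ := by positivity
  have hW : 0 ≤ W := by positivity
  have hNq : (0 : ℝ) ≤ N / (q + 1) := by positivity
  have hNP : (0 : ℝ) ≤ N / (P - m) := div_nonneg (by positivity) (by linarith)
  calc (D ^ 2 * Y + κ * D ^ 2 * Z) * W ≤ (D ^ 2 * Y + κ * D ^ 2 * ((N / (q + 1)) * Y)) * W := by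
        gcongr
    _ = D ^ 2 * (1 + κ * (N / (q + 1))) * Y * W := by ring
    _ ≤ D ^ 2 * (1 + κ * (N / (q + 1))) * ((N / (P - m)) * X) * W := by gcongr
    _ = D ^ 2 * (1 + κ * (N / (q + 1))) * (N / (P - m)) * (X * W) := by ring
    _ ≤ D ^ 2 * (1 + κ * (N / (q + 1))) * (N / (P - m)) * (K * y ^ 2) := by gcongr
    _ = _ := by ring


theorem two_numEdges (n : ℕ) : 2 * numEdges n = n * (n - 1) :=
  Nat.mul_div_cancel' (Nat.even_mul_pred_self n).two_dvd

theorem numEdges_real {n : ℕ} (hn : 1 ≤ n) : (numEdges n : ℝ) = n * (n - 1) / 2 := by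
  have h : ((2 * numEdges n : ℕ) : ℝ) = (n * (n - 1) : ℕ) := by rw [two_numEdges]
  push_cast [Nat.cast_sub hn] at h
  linarith

theorem Pr_le_one {n : ℕ} (p : Ord n → Prop) : Pr p ≤ 1 := by
  unfold Pr
  apply div_le_one_of_le₀ _ (by positivity)
  norm_cast
  exact Finset.card_le_univ _

theorem Pr_nonneg {n : ℕ} (p : Ord n → Prop) : 0 ≤ Pr p := by
  unfold Pr; positivity

open scoped Classical in
theorem upper_bound {n m k : ℕ} (hn : 2 ≤ n) (hm : m ≤ numEdges n) (hkm : k ≤ m)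
    (hkd : k ≤ n - 1) (hx : n ≤ 2 * m) :
    1 - Pr (fun σ : Ord n => ∀ v : Fin n, k ≤ deg (procEdges σ m) v) ≤
      n * (k * Real.exp (2 * k)) * ((2 * m / n : ℝ) ^ (k - 1) * Real.exp (-(2 * m / n : ℝ))) := by
  rw [Pr_eq hm]
  set N := numEdges n with hN
  set Ω := powersetCard m (univ : Finset (EdgeType n)) with hΩ
  have hΩc : Ω.card = N.choose m := by
    rw [hΩ, card_powersetCard, Finset.card_univ, card_edge]
  have hCp : (0 : ℝ) < N.choose m := by exact_mod_cast Nat.choose_pos hm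
  have hNr := numEdges_real (n := n) (by omega)
  rw [← hN] at hNr
  have hn2 : (2 : ℝ) ≤ n := by exact_mod_cast hn
  have hNp : (0 : ℝ) < N := by rw [hNr]; nlinarith
  have hNp' : 0 < N := by exact_mod_cast hNp
  have hdN : n - 1 ≤ N := by
    have := two_numEdges n
    have h2 : 2 * (n - 1) ≤ n * (n - 1) := Nat.mul_le_mul_right _ hn
    omega
  have hdr : ((n - 1 : ℕ) : ℝ) = n - 1 := by push_cast [Nat.cast_sub (show 1 ≤ n by omega)]; ring
  have hxe : ((n - 1 : ℕ) : ℝ) * m / N = 2 * m / n := by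
    rw [hNr, hdr]
    have : (n : ℝ) - 1 ≠ 0 := by linarith
    have : (n : ℝ) ≠ 0 := by linarith
    field_simp
  set x : ℝ := 2 * m / n with hxdef
  have hx1 : 1 ≤ x := by
    rw [hxdef, le_div_iff₀ (by linarith)]
    have : (n : ℝ) ≤ ((2 * m : ℕ) : ℝ) := by exact_mod_cast hx
    push_cast at this; linarith
  have hterm : ∀ v : Fin n, ∀ j ∈ Finset.range k,
      ((Ω.filter (fun T => (T ∩ star v).card = j)).card : ℝ) ≤
        Real.exp (2 * k) * (x ^ (k - 1) * Real.exp (-x)) * N.choose m := by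
    intro v j hj
    rw [Finset.mem_range] at hj
    rw [count_single (star v) (show j ≤ m by omega), star_card, card_edge, ← hN]
    push_cast
    by_cases hbig : m + (n - 1) ≤ N + j
    · have h1 := ratio_up N (n - 1) m j (by omega) hdN (by omega) hm hbig hNp'
      have h2 : ((n - 1).choose j : ℝ) ≤ ((n - 1 : ℕ) : ℝ) ^ j := by
        exact_mod_cast Nat.choose_le_pow (n - 1) j
      rw [hxe] at h1
      calc ((n - 1).choose j : ℝ) * ((N - (n - 1)).choose (m - j) : ℝ)
          ≤ ((n - 1 : ℕ) : ℝ) ^ j * (((m : ℝ) / N) ^ j * Real.exp (2 * j - x) * N.choose m) :=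
            mul_le_mul h2 h1 (by positivity) (by positivity)
        _ = x ^ j * Real.exp (2 * j - x) * N.choose m := by
            rw [← hxe, mul_div_assoc, mul_pow]; ring
        _ ≤ x ^ (k - 1) * (Real.exp (2 * k) * Real.exp (-x)) * N.choose m := by
            rw [← Real.exp_add]
            have : (j : ℝ) ≤ k := by exact_mod_cast hj.le
            apply mul_le_mul_of_nonneg_right _ hCp.le
            apply mul_le_mul _ _ (by positivity) (by positivity)
            · exact pow_le_pow_right₀ hx1 (by omega)
            · apply Real.exp_le_exp.2; linarith
        _ = _ := by ring
    · rw [Nat.choose_eq_zero_of_lt (show N - (n - 1) < m - j by omega)]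
      simp only [Nat.cast_zero, mul_zero]
      positivity
  have hbad : ((Ω.filter (fun T => ¬ ∀ v, k ≤ (T ∩ star v).card)).card : ℝ) ≤
      ∑ v : Fin n, ∑ j ∈ Finset.range k,
        ((Ω.filter (fun T => (T ∩ star v).card = j)).card : ℝ) := by
    have hsub : Ω.filter (fun T => ¬ ∀ v, k ≤ (T ∩ star v).card) ⊆
        (univ : Finset (Fin n)).biUnion (fun v => (Finset.range k).biUnion
          (fun j => Ω.filter (fun T => (T ∩ star v).card = j))) := by
      intro T hT
      rw [Finset.mem_filter] at hT
      obtain ⟨hT, h⟩ := hT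
      push Not at h
      obtain ⟨v, hv⟩ := h
      simp only [Finset.mem_biUnion, Finset.mem_univ, true_and, Finset.mem_range, Finset.mem_filter]
      exact ⟨v, _, hv, hT, rfl⟩
    have h1 := (Finset.card_le_card hsub).trans Finset.card_biUnion_le
    have h2 := h1.trans (Finset.sum_le_sum (fun v _ => Finset.card_biUnion_le))
    exact_mod_cast h2
  have hsum : ((Ω.filter (fun T => ¬ ∀ v, k ≤ (T ∩ star v).card)).card : ℝ) ≤
      n * (k * (Real.exp (2 * k) * (x ^ (k - 1) * Real.exp (-x)) * N.choose m)) := by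
    refine hbad.trans ?_
    refine (Finset.sum_le_sum (fun v _ => Finset.sum_le_sum (hterm v))).trans (le_of_eq ?_)
    simp
  have hadd := Finset.card_filter_add_card_filter_not (s := Ω) (fun T => ∀ v, k ≤ (T ∩ star v).card)
  have hadd' : ((Ω.filter (fun T => ∀ v, k ≤ (T ∩ star v).card)).card : ℝ) +
      ((Ω.filter (fun T => ¬ ∀ v, k ≤ (T ∩ star v).card)).card : ℝ) = N.choose m := by
    rw [← hΩc]; exact_mod_cast hadd
  rw [sub_le_iff_le_add, ← sub_le_iff_le_add', le_div_iff₀ hCp]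
  nlinarith

/-- the pair correlation factor -/
noncomputable def rho (n m j : ℕ) : ℝ :=
  ((numEdges n : ℝ) / (numEdges n - (n - 1 : ℕ))) ^ j *
    (numEdges n / (numEdges n - 2 * (n - 1 : ℕ) - m)) *
      (1 + ((j : ℝ) / (n - 1 : ℕ)) ^ 2 * (numEdges n / (m - 2 * j + 1)))

open scoped Classical in
theorem lower_bound {n m j : ℕ} (hn : 2 ≤ n) (hjd : 2 * j ≤ n - 1) (hjm : 2 * j ≤ m)
    (hmd : m + 2 * (n - 1) < numEdges n) (hbig : j * numEdges n ≤ (m - j) * (n - 1)) :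
    Pr (fun σ : Ord n => ∀ v : Fin n, j + 1 ≤ deg (procEdges σ m) v) ≤
      (n * ((j.factorial : ℝ)⁻¹ * (2 * m / n / 4 : ℝ) ^ j *
        Real.exp (-(((n - 1 : ℕ) : ℝ) * ((n - 1 : ℕ) + m) / (numEdges n - (n - 1 : ℕ) - m)))))⁻¹ +
      (rho n m j - 1) := by
  have hm : m ≤ numEdges n := by omega
  rw [Pr_eq hm]
  have hpr := pair_ratio (numEdges n) (n - 1) m j (by omega) (by omega) hjm hmd hbig
  have hlow := ratio_low (numEdges n) (n - 1) m j (by omega) hjm (by omega)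
  set N := numEdges n with hN
  set d := n - 1 with hd
  set Ω := powersetCard m (univ : Finset (EdgeType n)) with hΩ
  have hΩc : Ω.card = N.choose m := by
    rw [hΩ, card_powersetCard, Finset.card_univ, card_edge]
  have hC0 : 0 < N.choose m := Nat.choose_pos hm
  have hCp : (0 : ℝ) < N.choose m := by exact_mod_cast hC0
  have hNr := numEdges_real (n := n) (by omega)
  rw [← hN] at hNr
  have hn2 : (2 : ℝ) ≤ n := by exact_mod_cast hn
  have hNp : (0 : ℝ) < N := by rw [hNr]; nlinarith
  have hdr : (d : ℝ) = n - 1 := by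
    rw [hd]; push_cast [Nat.cast_sub (show 1 ≤ n by omega)]; ring
  have hxe : (d : ℝ) * m / N = 2 * m / n := by
    rw [hNr, hdr]
    have : (n : ℝ) - 1 ≠ 0 := by linarith
    have : (n : ℝ) ≠ 0 := by linarith
    field_simp
  set c : ℝ := (d.choose j : ℝ) * (N - d).choose (m - j) with hc
  set b : ℝ := (d.choose j : ℝ) ^ 2 * (N - (2 * d - 1)).choose (m - 2 * j) +
      ((j : ℝ) / d) ^ 2 * (d.choose j : ℝ) ^ 2 *
        (N - (2 * d - 1)).choose (m - 2 * j + 1) with hb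
  have hcp : 0 < c := by
    have h1 : 0 < d.choose j := Nat.choose_pos (by omega)
    have h2 : 0 < (N - d).choose (m - j) := Nat.choose_pos (by omega)
    rw [hc]; positivity
  have hbp : 0 ≤ b := by positivity
  have sm := second_moment (V := Fin n) Ω (fun v T => (T ∩ star v).card = j) c b hcp hbp
    (by simp; omega) (by rw [hΩc]; exact hC0)
    (by
      intro v
      have := count_single (star v) (show j ≤ m by omega)
      rw [star_card, card_edge, ← hN, ← hd] at this
      have h' : (((powersetCard m (univ : Finset (EdgeType n))).filter
          (fun T => (T ∩ star v).card = j)).card : ℝ) = c := by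
        rw [hc]; exact_mod_cast this
      rw [← h']; congr!)
    (by
      intro u v huv
      obtain ⟨e, he⟩ := star_inter huv
      have := count_pair (star u) (star v) e he (star_card u) (star_card v) (by omega) hjm
      rw [card_edge] at this
      refine le_trans (le_of_eq ?_) this
      congr!)
  rw [hΩc, Fintype.card_fin] at sm
  have hmono : ((Ω.filter (fun T => ∀ v, j + 1 ≤ (T ∩ star v).card)).card : ℝ) / N.choose m ≤
      ((Ω.filter (fun T => ∀ v, ¬ (T ∩ star v).card = j)).card : ℝ) / N.choose m := by
    apply div_le_div_of_nonneg_right _ hCp.le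
    norm_cast
    apply Finset.card_le_card
    intro T hT
    rw [Finset.mem_filter] at hT ⊢
    refine ⟨hT.1, fun v => ?_⟩
    have := hT.2 v
    omega
  refine hmono.trans (le_trans (le_of_eq (by congr!)) (sm.trans ?_))
  apply add_le_add
  · have hlo : (j.factorial : ℝ)⁻¹ * (2 * m / n / 4 : ℝ) ^ j *
        Real.exp (-((d : ℝ) * (d + m) / (N - d - m))) * N.choose m ≤ c := by
      have h1 : (j.factorial : ℝ)⁻¹ * ((d : ℝ) / 2) ^ j ≤ d.choose j := by
        have a1 : (d + 1 - j) ^ j ≤ j.factorial * d.choose j := by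
          rw [← Nat.descFactorial_eq_factorial_mul_choose]
          exact Nat.pow_sub_le_descFactorial d j
        have a2 : ((d + 1 - j : ℕ) : ℝ) ^ j ≤ j.factorial * d.choose j := by exact_mod_cast a1
        have a3 : (d : ℝ) / 2 ≤ ((d + 1 - j : ℕ) : ℝ) := by
          have : d ≤ 2 * (d + 1 - j) := by omega
          have : (d : ℝ) ≤ ((2 * (d + 1 - j) : ℕ) : ℝ) := by exact_mod_cast this
          rw [Nat.cast_mul] at this; push_cast at this ⊢; linarith
        have a4 := (pow_le_pow_left₀ (by positivity) a3 j).trans a2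
        rw [inv_mul_le_iff₀ (by positivity)]
        exact a4
      calc _ = ((j.factorial : ℝ)⁻¹ * ((d : ℝ) / 2) ^ j) * (((m : ℝ) / (2 * N)) ^ j *
            Real.exp (-((d : ℝ) * (d + m) / (N - d - m))) * N.choose m) := by
            have : (2 * m / n / 4 : ℝ) = (d : ℝ) / 2 * ((m : ℝ) / (2 * N)) := by
              rw [← hxe]; field_simp; norm_num
            rw [this, mul_pow]; ring
        _ ≤ _ := mul_le_mul h1 hlow (by positivity) (by positivity)
    set z : ℝ := (j.factorial : ℝ)⁻¹ * (2 * m / n / 4 : ℝ) ^ j *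
        Real.exp (-((d : ℝ) * (d + m) / (N - d - m))) with hz
    have hnp : (0 : ℝ) < n := by linarith
    rcases eq_or_lt_of_le (show 0 ≤ z by positivity) with h0 | hzp
    · exfalso
      have hm0 : m = 0 ∧ j ≠ 0 := by
        have h1 : (2 * m / n / 4 : ℝ) ^ j = 0 := by
          rcases mul_eq_zero.1 h0.symm with h | h
          · rcases mul_eq_zero.1 h with h | h
            · have : (j.factorial : ℝ)⁻¹ ≠ 0 := by positivity
              exact absurd h this
            · exact h
          · exact absurd h (Real.exp_ne_zero _)
        rw [pow_eq_zero_iff'] at h1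
        refine ⟨?_, h1.2⟩
        have := h1.1
        have hn0 : (n : ℝ) ≠ 0 := hnp.ne'
        field_simp at this
        simpa using this
      omega
    · rw [← one_div, div_le_div_iff₀ (by positivity) (by positivity)]
      nlinarith
  · have : (N.choose m : ℝ) * b / c ^ 2 ≤ rho n m j := by
      rw [div_le_iff₀ (by positivity), mul_comm]
      exact hpr
    linarith


open Topology

theorem tendsto_logn : Tendsto (fun n : ℕ => Real.log n) atTop atTop :=
  Real.tendsto_log_atTop.comp tendsto_natCast_atTop_atTop

theorem part_one (k : ℕ) (hk : 1 ≤ k) (m : ℕ → ℕ) (u : ℕ → ℝ)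
    (hm : ∀ᶠ n : ℕ in atTop, m n ≤ numEdges n)
    (hu : ∀ᶠ n : ℕ in atTop,
      (2 * m n / n : ℝ) = Real.log n + ((k : ℝ) - 1) * Real.log (Real.log n) + u n)
    (hut : Tendsto u atTop atTop) :
    Tendsto (fun n : ℕ => Pr (fun σ : Ord n => ∀ v : Fin n, k ≤ deg (procEdges σ (m n)) v))
        atTop (𝓝 1) := by
  have hlim : Tendsto (fun n : ℕ => 1 - (k * Real.exp (2 * k)) *
      ((k + u n) ^ (k - 1) * Real.exp (-(u n)))) atTop (𝓝 1) := by
    have h1 : Tendsto (fun y : ℝ => y ^ (k - 1) * Real.exp (-y)) atTop (𝓝 0) :=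
      Real.tendsto_pow_mul_exp_neg_atTop_nhds_zero (k - 1)
    have h2 : Tendsto (fun n => (k : ℝ) + u n) atTop atTop := tendsto_atTop_add_const_left _ _ hut
    have h3 := ((h1.comp h2).const_mul (Real.exp k)).const_mul (k * Real.exp (2 * k))
    have h4 := h3.const_sub 1
    simp only [mul_zero, sub_zero] at h4
    refine h4.congr fun n => ?_
    simp only [Function.comp]
    have : Real.exp (-(u n)) = Real.exp k * Real.exp (-(k + u n)) := by
      rw [← Real.exp_add]; congr 1; ring
    rw [this]; ring
  refine tendsto_of_tendsto_of_tendsto_of_le_of_le' hlim tendsto_const_nhds ?_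
    (Eventually.of_forall fun n => Pr_le_one _)
  filter_upwards [hm, hu, hut.eventually_ge_atTop 0, tendsto_logn.eventually_ge_atTop 1,
    eventually_ge_atTop (2 * k + 2)] with n hm hu hu0 hL hn
  have hnr : (2 * (k : ℝ) + 2) ≤ n := by exact_mod_cast hn
  have hk1 : (1 : ℝ) ≤ k := by exact_mod_cast hk
  have hnp : (0 : ℝ) < n := by linarith
  set L := Real.log n with hLdef
  have hLL : 0 ≤ Real.log L := Real.log_nonneg hL
  have hLL2 : Real.log L ≤ L := by
    have := Real.log_le_sub_one_of_pos (show 0 < L by linarith); linarith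
  set x : ℝ := 2 * m n / n with hx
  have hprod : 0 ≤ ((k : ℝ) - 1) * Real.log L := mul_nonneg (by linarith) hLL
  have hxL : L ≤ x := by rw [hu]; linarith
  have hx1 : 1 ≤ x := hL.trans hxL
  have hnm : n ≤ 2 * m n := by
    rw [hx, le_div_iff₀ hnp] at hx1
    have : (n : ℝ) ≤ ((2 * m n : ℕ) : ℝ) := by push_cast; linarith
    exact_mod_cast this
  have hub := upper_bound (n := n) (m := m n) (k := k) (by omega) hm (by omega) (by omega) hnm
  rw [← hx] at hub
  have hexp : Real.exp (-x) = (n : ℝ)⁻¹ * (L ^ (k - 1))⁻¹ * Real.exp (-(u n)) := by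
    have e1 : (n : ℝ) = Real.exp L := (Real.exp_log hnp).symm
    have e2 : L ^ (k - 1) = Real.exp (((k : ℝ) - 1) * Real.log L) := by
      have : ((k : ℝ) - 1) = ((k - 1 : ℕ) : ℝ) := by push_cast [Nat.cast_sub hk]; ring
      rw [this, Real.exp_nat_mul, Real.exp_log (by linarith)]
    rw [e2, e1, ← Real.exp_neg, ← Real.exp_neg, ← Real.exp_add, ← Real.exp_add]
    congr 1; rw [hu]; ring
  have hxk : x ≤ L * (k + u n) := by
    rw [hu]
    have : ((k : ℝ) - 1) * Real.log L ≤ (k - 1) * L := mul_le_mul_of_nonneg_left hLL2 (by linarith)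
    nlinarith
  have hLp : 0 < L := by linarith
  have hfin : n * (k * Real.exp (2 * k)) * (x ^ (k - 1) * Real.exp (-x)) ≤
      (k * Real.exp (2 * k)) * ((k + u n) ^ (k - 1) * Real.exp (-(u n))) := by
    have hxp : x ^ (k - 1) ≤ L ^ (k - 1) * (k + u n) ^ (k - 1) := by
      rw [← mul_pow]; exact pow_le_pow_left₀ (by linarith) hxk _
    calc n * (k * Real.exp (2 * k)) * (x ^ (k - 1) * Real.exp (-x))
        ≤ n * (k * Real.exp (2 * k)) * ((L ^ (k - 1) * (k + u n) ^ (k - 1)) * Real.exp (-x)) := by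
          gcongr
      _ = _ := by
          rw [hexp]
          have : L ^ (k - 1) ≠ 0 := by positivity
          field_simp
  linarith

theorem rho_tendsto (j : ℕ) (m : ℕ → ℕ)
    (h1 : ∀ᶠ n : ℕ in atTop, (n : ℝ) * Real.log n / 4 ≤ m n)
    (h2 : ∀ᶠ n : ℕ in atTop, (m n : ℝ) ≤ n * Real.log n) :
    Tendsto (fun n => rho n (m n) j) atTop (𝓝 1) := by
  have hinv : Tendsto (fun n : ℕ => (2 : ℝ) / n) atTop (𝓝 0) :=
    tendsto_const_nhds.div_atTop tendsto_natCast_atTop_atTop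
  have hdN : Tendsto (fun n : ℕ => ((n - 1 : ℕ) : ℝ) / numEdges n) atTop (𝓝 0) := by
    refine hinv.congr' ?_
    filter_upwards [eventually_ge_atTop 2] with n hn
    have hn2 : (2 : ℝ) ≤ n := by exact_mod_cast hn
    rw [numEdges_real (by omega), Nat.cast_sub (by omega)]
    have : (n : ℝ) - 1 ≠ 0 := by linarith
    have : (n : ℝ) ≠ 0 := by linarith
    push_cast
    field_simp
  have hlogn : Tendsto (fun n : ℕ => Real.log n / n) atTop (𝓝 0) := by
    have := (Real.isLittleO_log_id_atTop.tendsto_div_nhds_zero).comp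
      (tendsto_natCast_atTop_atTop (R := ℝ))
    exact this
  have hmN : Tendsto (fun n : ℕ => (m n : ℝ) / numEdges n) atTop (𝓝 0) := by
    have hl : Tendsto (fun n : ℕ => 4 * (Real.log n / n)) atTop (𝓝 0) := by
      simpa using hlogn.const_mul 4
    refine tendsto_of_tendsto_of_tendsto_of_le_of_le' tendsto_const_nhds hl
      (Eventually.of_forall fun n => by positivity) ?_
    filter_upwards [eventually_ge_atTop 2, h2, tendsto_logn.eventually_ge_atTop 1] with n hn h2 hL
    have hn2 : (2 : ℝ) ≤ n := by exact_mod_cast hn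
    rw [numEdges_real (by omega), div_le_iff₀ (by nlinarith)]
    refine h2.trans ?_
    have : 4 * (Real.log n / n) * ((n : ℝ) * (n - 1) / 2) = Real.log n * (2 * (n - 1)) := by
      have : (n : ℝ) ≠ 0 := by linarith
      field_simp; ring
    rw [this]
    nlinarith
  have hmt : Tendsto (fun n : ℕ => (m n : ℝ)) atTop atTop := by
    refine tendsto_atTop_mono' _ ?_ (tendsto_natCast_atTop_atTop (R := ℝ))
    filter_upwards [h1, tendsto_logn.eventually_ge_atTop 4] with n h1 hL
    refine le_trans ?_ h1
    have := (Nat.cast_nonneg n : (0 : ℝ) ≤ n)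
    nlinarith
  have f1 : Tendsto (fun n : ℕ => ((numEdges n : ℝ) / (numEdges n - (n - 1 : ℕ))) ^ j) atTop (𝓝 1) := by
    have : Tendsto (fun n : ℕ => ((1 - ((n - 1 : ℕ) : ℝ) / numEdges n)⁻¹) ^ j) atTop (𝓝 1) := by
      have := ((hdN.const_sub 1).inv₀ (by norm_num)).pow j
      simpa using this
    refine this.congr' ?_
    filter_upwards [eventually_ge_atTop 2] with n hn
    have hn2 : (2 : ℝ) ≤ n := by exact_mod_cast hn
    have hNp : (0 : ℝ) < numEdges n := by rw [numEdges_real (by omega)]; nlinarith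
    congr 1
    rw [one_sub_div hNp.ne', inv_div]
  have f2 : Tendsto (fun n : ℕ => (numEdges n : ℝ) / (numEdges n - 2 * (n - 1 : ℕ) - m n)) atTop (𝓝 1) := by
    have : Tendsto (fun n : ℕ => (1 - 2 * (((n - 1 : ℕ) : ℝ) / numEdges n) -
        (m n : ℝ) / numEdges n)⁻¹) atTop (𝓝 1) := by
      have := (((hdN.const_mul 2).const_sub 1).sub hmN).inv₀ (by norm_num)
      simpa using this
    refine this.congr' ?_
    filter_upwards [eventually_ge_atTop 2] with n hn
    have hn2 : (2 : ℝ) ≤ n := by exact_mod_cast hn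
    have hNp : (0 : ℝ) < numEdges n := by rw [numEdges_real (by omega)]; nlinarith
    rw [← inv_div]
    congr 1
    field_simp
  have f3 : Tendsto (fun n : ℕ => ((j : ℝ) / (n - 1 : ℕ)) ^ 2 * (numEdges n / (m n - 2 * j + 1)))
      atTop (𝓝 0) := by
    have hden : Tendsto (fun n : ℕ => (m n : ℝ) - 2 * j + 1) atTop atTop := by
      have := tendsto_atTop_add_const_right atTop (-2 * (j : ℝ) + 1) hmt
      refine this.congr fun n => by ring
    have hl : Tendsto (fun n : ℕ => (j : ℝ) ^ 2 / (m n - 2 * j + 1)) atTop (𝓝 0) :=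
      tendsto_const_nhds.div_atTop hden
    refine tendsto_of_tendsto_of_tendsto_of_le_of_le' tendsto_const_nhds hl ?_ ?_
    · filter_upwards [hden.eventually_gt_atTop 0] with n hn
      positivity
    · filter_upwards [hden.eventually_gt_atTop 0, eventually_ge_atTop 2] with n hp hn
      have hn2 : (2 : ℝ) ≤ n := by exact_mod_cast hn
      rw [numEdges_real (by omega), Nat.cast_sub (by omega), Nat.cast_one, ← mul_div_assoc]
      apply div_le_div_of_nonneg_right _ hp.le
      rw [div_pow, div_mul_eq_mul_div, div_le_iff₀ (by nlinarith)]
      apply mul_le_mul_of_nonneg_left _ (by positivity)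
      nlinarith
  have := (f1.mul f2).mul (f3.const_add 1)
  simp only [add_zero, mul_one] at this
  exact this

theorem part_two (j : ℕ) (m : ℕ → ℕ)
    (h1 : ∀ᶠ n : ℕ in atTop, (n : ℝ) * Real.log n / 4 ≤ m n)
    (h2 : ∀ᶠ n : ℕ in atTop, (m n : ℝ) ≤ n * Real.log n)
    (hg : Tendsto (fun n : ℕ => Real.log n + j * Real.log (Real.log n) - 2 * m n / n) atTop atTop) :
    Tendsto (fun n : ℕ => Pr (fun σ : Ord n => ∀ v : Fin n, j + 1 ≤ deg (procEdges σ (m n)) v))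
        atTop (𝓝 0) := by
  set g : ℕ → ℝ := fun n => Real.log n + j * Real.log (Real.log n) - 2 * m n / n with hgdef
  have hlim : Tendsto (fun n : ℕ => (j.factorial * 8 ^ j * Real.exp 5) * Real.exp (-(g n)) +
      (rho n (m n) j - 1)) atTop (𝓝 0) := by
    have a := (Real.tendsto_exp_neg_atTop_nhds_zero.comp hg).const_mul
      (j.factorial * 8 ^ j * Real.exp 5)
    have b := (rho_tendsto j m h1 h2).sub_const 1
    have := a.add b
    simpa using this
  refine tendsto_of_tendsto_of_tendsto_of_le_of_le' tendsto_const_nhds hlim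
    (Eventually.of_forall fun n => Pr_nonneg _) ?_
  have hsq : ∀ᶠ n : ℕ in atTop, Real.log n ^ 2 ≤ (1 / 100) * n := by
    have := (Real.isLittleO_pow_log_id_atTop (n := 2)).comp_tendsto
      (tendsto_natCast_atTop_atTop (R := ℝ))
    filter_upwards [this.bound (show (0 : ℝ) < 1 / 100 by norm_num)] with n hn
    simpa using hn
  filter_upwards [h1, h2, hsq, tendsto_logn.eventually_ge_atTop (4 * (j : ℝ) + 4),
    eventually_ge_atTop (100 * j + 100)] with n h1 h2 hsq hL hn
  have hj0 := (Nat.cast_nonneg j : (0 : ℝ) ≤ j)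
  have hnr : 100 * (j : ℝ) + 100 ≤ n := by exact_mod_cast hn
  have hnp : (0 : ℝ) < n := by linarith
  set L := Real.log n with hLdef
  have hLp : 0 < L := by linarith
  have hLn : L ≤ n / 100 := by nlinarith
  have hNr := numEdges_real (n := n) (by omega)
  have hdr : ((n - 1 : ℕ) : ℝ) = n - 1 := by push_cast [Nat.cast_sub (show 1 ≤ n by omega)]; ring
  have hnL : n * L ≤ n * (n / 100) := mul_le_mul_of_nonneg_left hLn hnp.le
  have hmj : (n : ℝ) * (j + 1) ≤ m n := by
    refine le_trans ?_ h1
    nlinarith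
  have c1 : 2 * j ≤ m n := by
    have : ((2 * j : ℕ) : ℝ) ≤ m n := by push_cast; nlinarith
    exact_mod_cast this
  have c2 : m n + 2 * (n - 1) < numEdges n := by
    have : ((m n + 2 * (n - 1) : ℕ) : ℝ) < numEdges n := by
      rw [Nat.cast_add, Nat.cast_mul, hdr, hNr]; push_cast; nlinarith
    exact_mod_cast this
  have c3 : j * numEdges n ≤ (m n - j) * (n - 1) := by
    have : ((j * numEdges n : ℕ) : ℝ) ≤ ((m n - j) * (n - 1) : ℕ) := by
      rw [Nat.cast_mul, Nat.cast_mul, hdr, hNr, Nat.cast_sub (by omega)]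
      have : (j : ℝ) * n / 2 ≤ m n - j := by nlinarith
      have h' := mul_le_mul_of_nonneg_right this (show (0 : ℝ) ≤ n - 1 by linarith)
      linarith
    exact_mod_cast this
  have lb := lower_bound (n := n) (m := m n) (j := j) (by omega) (by omega) c1 c2 c3
  refine lb.trans ?_
  apply add_le_add _ le_rfl
  set x : ℝ := 2 * m n / n with hx
  have hxlow : L / 2 ≤ x := by rw [hx, le_div_iff₀ hnp]; linarith
  have hxup : x ≤ 2 * L := by rw [hx, div_le_iff₀ hnp]; linarith
  have hE : ((n - 1 : ℕ) : ℝ) * ((n - 1 : ℕ) + m n) / (numEdges n - (n - 1 : ℕ) - m n) ≤ x + 5 := by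
    have hden : (n : ℝ) ^ 2 / 4 ≤ numEdges n - (n - 1 : ℕ) - m n := by
      rw [hdr, hNr]; nlinarith
    have hdenp : (0 : ℝ) < numEdges n - (n - 1 : ℕ) - m n := lt_of_lt_of_le (by positivity) hden
    rw [div_le_iff₀ hdenp]
    have key : ((n - 1 : ℕ) : ℝ) * m n = x * numEdges n := by
      rw [hx, hdr, hNr]; field_simp
    have k1 : x * (((n - 1 : ℕ) : ℝ) + m n) ≤ n ^ 2 / 4 := by
      calc x * (((n - 1 : ℕ) : ℝ) + m n) ≤ (2 * L) * (n + n * L) := by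
            apply mul_le_mul hxup _ (by positivity) (by positivity)
            rw [hdr]; linarith
        _ ≤ (2 * L) * (n * L + n * L) := by
            apply mul_le_mul_of_nonneg_left _ (by positivity)
            nlinarith
        _ = 4 * n * L ^ 2 := by ring
        _ ≤ 4 * n * (1 / 100 * n) := by gcongr
        _ ≤ _ := by nlinarith
    have k2 : ((n - 1 : ℕ) : ℝ) * (n - 1 : ℕ) ≤ n ^ 2 := by rw [hdr]; nlinarith
    nlinarith
  have hexpg : Real.exp (g n) = n * L ^ j * Real.exp (-x) := by
    have e1 : (n : ℝ) = Real.exp L := (Real.exp_log hnp).symm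
    have e2 : L ^ j = Real.exp (j * Real.log L) := by
      rw [Real.exp_nat_mul, Real.exp_log hLp]
    rw [e2]
    nth_rewrite 1 [e1]
    rw [← Real.exp_add, ← Real.exp_add]
    congr 1
  have hC : (0 : ℝ) < j.factorial * 8 ^ j * Real.exp 5 := by positivity
  rw [Real.exp_neg (g n), ← inv_inv ((j.factorial : ℝ) * 8 ^ j * Real.exp 5), ← mul_inv]
  apply inv_anti₀ (by positivity)
  rw [hexpg]
  have hxj : (L / 8) ^ j ≤ (x / 4) ^ j := by
    apply pow_le_pow_left₀ (by positivity); linarith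
  have hee : Real.exp (-x) * (Real.exp 5)⁻¹ ≤ Real.exp
      (-(((n - 1 : ℕ) : ℝ) * ((n - 1 : ℕ) + m n) / (numEdges n - (n - 1 : ℕ) - m n))) := by
    rw [← Real.exp_neg, ← Real.exp_add]
    apply Real.exp_le_exp.2; linarith
  calc (j.factorial * 8 ^ j * Real.exp 5 : ℝ)⁻¹ * (n * L ^ j * Real.exp (-x))
      = n * ((j.factorial : ℝ)⁻¹ * (L / 8) ^ j * (Real.exp (-x) * (Real.exp 5)⁻¹)) := by
        rw [div_pow]; field_simp
    _ ≤ _ := by gcongr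

/-- Erdős–Rényi. Let `k ≥ 1` be a fixed integer and `f : ℕ → ℝ` be such
that `m = m(n) = ⌊(n/2)·(log n + (k−1)·log log n + f(n))⌋` satisfies `0 ≤ m ≤ N` for all
large `n`. If `f(n) → ∞` then `P[δ(G_{n,m}) ≥ k] → 1`; if `f(n) → −∞` then this
probability tends to `0`. -/
theorem min_degree_hitting (k : ℕ) (hk : 1 ≤ k) (f : ℕ → ℝ) (m : ℕ → ℕ)
    (hm : ∀ᶠ n : ℕ in Filter.atTop,
      (m n : ℤ) = ⌊((n : ℝ) / 2) * (Real.log n + ((k : ℝ) - 1) * Real.log (Real.log n) + f n)⌋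
        ∧ m n ≤ numEdges n) :
    (Filter.Tendsto f Filter.atTop Filter.atTop →
      Filter.Tendsto
        (fun n : ℕ => Pr (fun σ : Ord n => ∀ v : Fin n, k ≤ deg (procEdges σ (m n)) v))
        Filter.atTop (nhds 1)) ∧
    (Filter.Tendsto f Filter.atTop Filter.atBot →
      Filter.Tendsto
        (fun n : ℕ => Pr (fun σ : Ord n => ∀ v : Fin n, k ≤ deg (procEdges σ (m n)) v))
        Filter.atTop (nhds 0)) := by
  have hfl : ∀ᶠ n : ℕ in Filter.atTop,
      (m n : ℝ) ≤ ((n : ℝ) / 2) * (Real.log n + ((k : ℝ) - 1) * Real.log (Real.log n) + f n) ∧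
      ((n : ℝ) / 2) * (Real.log n + ((k : ℝ) - 1) * Real.log (Real.log n) + f n) ≤ m n + 1 := by
    filter_upwards [hm] with n hn
    have h1 := Int.floor_le (((n : ℝ) / 2) * (Real.log n + ((k : ℝ) - 1) * Real.log (Real.log n) + f n))
    have h2 := Int.lt_floor_add_one (((n : ℝ) / 2) * (Real.log n + ((k : ℝ) - 1) * Real.log (Real.log n) + f n))
    rw [← hn.1] at h1 h2
    push_cast at h1 h2
    exact ⟨h1, h2.le⟩
  constructor
  · intro hf
    apply part_one k hk m
      (fun n => 2 * m n / n - (Real.log n + ((k : ℝ) - 1) * Real.log (Real.log n)))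
      (hm.mono fun n h => h.2) (Eventually.of_forall fun n => by ring)
    refine tendsto_atTop_mono' _ ?_ (tendsto_atTop_add_const_right atTop (-1 : ℝ) hf)
    filter_upwards [hfl, eventually_ge_atTop 2] with n h hn
    have hn2 : (2 : ℝ) ≤ n := by exact_mod_cast hn
    have : Real.log n + ((k : ℝ) - 1) * Real.log (Real.log n) + f n - 1 ≤ 2 * m n / n := by
      rw [le_div_iff₀ (by linarith)]
      nlinarith [h.2]
    linarith
  · intro hf
    obtain ⟨j, rfl⟩ : ∃ j, k = j + 1 := ⟨k - 1, by omega⟩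
    have hj : ((j + 1 : ℕ) : ℝ) - 1 = j := by push_cast; ring
    rw [hj] at hfl
    set m' : ℕ → ℕ := fun n => max (m n) ⌈(n : ℝ) * Real.log n / 4⌉₊ with hm'
    have hloglog : ∀ᶠ n : ℕ in atTop, (j : ℝ) * Real.log (Real.log n) ≤ Real.log n := by
      have := (Real.isLittleO_log_id_atTop.comp_tendsto tendsto_logn).bound
        (show (0 : ℝ) < 1 / (j + 1) by positivity)
      filter_upwards [this, tendsto_logn.eventually_ge_atTop 1] with n hn hL
      simp only [Function.comp, id, Real.norm_eq_abs] at hn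
      rw [abs_of_nonneg (Real.log_nonneg hL), abs_of_nonneg (by linarith)] at hn
      have h0 := Real.log_nonneg hL
      rw [one_div, inv_mul_eq_div, le_div_iff₀ (by positivity)] at hn
      nlinarith
    have key := part_two j m' ?_ ?_ ?_
    · refine tendsto_of_tendsto_of_tendsto_of_le_of_le tendsto_const_nhds key
        (fun n => Pr_nonneg _) (fun n => Pr_mono (le_max_left _ _) _)
    · refine Eventually.of_forall fun n => ?_
      refine (Nat.le_ceil _).trans ?_
      exact_mod_cast le_max_right _ _
    · filter_upwards [hfl, hloglog, hf.eventually_le_atBot 0, tendsto_logn.eventually_ge_atTop 4,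
        eventually_ge_atTop 2] with n h hll hf0 hL hn
      have hn2 : (2 : ℝ) ≤ n := by exact_mod_cast hn
      simp only [hm', Nat.cast_max]
      apply max_le
      · refine h.1.trans ?_
        have : Real.log n + j * Real.log (Real.log n) + f n ≤ 2 * Real.log n := by linarith
        nlinarith
      · refine (Nat.ceil_lt_add_one (by positivity)).le.trans ?_
        nlinarith
    · have hmin : Tendsto (fun n : ℕ => min (-(f n)) (Real.log n / 2 - 1)) atTop atTop := by
        have t1 : Tendsto (fun n : ℕ => -(f n)) atTop atTop := tendsto_neg_atBot_atTop.comp hf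
        have t2 : Tendsto (fun n : ℕ => Real.log n / 2 + (-1)) atTop atTop :=
          tendsto_atTop_add_const_right _ _ (tendsto_logn.atTop_div_const (by norm_num))
        refine tendsto_atTop.2 fun b => ?_
        filter_upwards [t1.eventually_ge_atTop b, t2.eventually_ge_atTop b] with n a1 a2
        exact le_min a1 (by linarith)
      refine tendsto_atTop_mono' _ ?_ hmin
      filter_upwards [hfl, tendsto_logn.eventually_ge_atTop 4,
        eventually_ge_atTop 2] with n h hL hn
      have hn2 : (2 : ℝ) ≤ n := by exact_mod_cast hn
      have hnp : (0 : ℝ) < n := by linarith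
      have h0 : 0 ≤ (j : ℝ) * Real.log (Real.log n) :=
        mul_nonneg (by positivity) (Real.log_nonneg (by linarith))
      rcases max_choice (m n) ⌈(n : ℝ) * Real.log n / 4⌉₊ with hc | hc
      · refine (min_le_left _ _).trans ?_
        simp only [hm', hc]
        have : 2 * (m n : ℝ) / n ≤ Real.log n + j * Real.log (Real.log n) + f n := by
          rw [div_le_iff₀ hnp]; linarith [h.1]
        linarith
      · refine (min_le_right _ _).trans ?_
        simp only [hm', hc]
        have hce := (Nat.ceil_lt_add_one (show 0 ≤ (n : ℝ) * Real.log n / 4 by positivity)).le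
        have : 2 * (⌈(n : ℝ) * Real.log n / 4⌉₊ : ℝ) / n ≤ Real.log n / 2 + 1 := by
          rw [div_le_iff₀ hnp]; linarith
        linarith

end RGP
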